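/- Suppose p ≤ 1/2 and β ∈ [0,1]. Then for every ε > 0 and every initial configuration S₀ ∈ 𝒟∖{𝒟₀}, the relaxation time of the discrete-time exclusion-voter chain satisfies E_{β,p}[τ^{2+ε} | ξ₀ = S₀] = ∞. -/

import Mathlib

open MeasureTheory Filter
open scoped ENNReal NNReal

namespace EV

/-- A configuration of the exclusion-voter model is the finite hybrid-zone word
(`false` = 0, `true` = 1); the full two-sided configuration is `1^∞ w 0^∞`. -/
abbrev Word := List Bool

/-- Canonical (normalized) words: empty (the ground state `𝒟₀`) or starting with
a `0` and ending with a `1`; these are in bijection with the configuration space `𝒟`. -/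
def IsConfig (w : Word) : Prop :=
  w = [] ∨ (w.head? = some false ∧ w.getLast? = some true)

/-- The ground-state Heaviside configuration `𝒟₀ = …111000…`. -/
def groundState : Word := []

/-- Pad a word with one boundary symbol of the adjacent infinite block on each side. -/
def pad (w : Word) : Word := true :: (w ++ [false])

/-- Normalize: strip leading `1`s (they merge into the left infinite block of `1`s)
and trailing `0`s (they merge into the right infinite block of `0`s). -/
def strip (w : Word) : Word :=
  ((w.dropWhile (· = true)).reverse.dropWhile (· = false)).reverse

def setPair (w : Word) (i : ℕ) (a b : Bool) : Word := (w.set i a).set (i + 1) b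

def swapPair (w : Word) (i : ℕ) : Word :=
  setPair w i (w.getD (i + 1) true) (w.getD i true)

/-- Indices of the unlike adjacent pairs (`01` or `10`), read off the padded word. -/
def unlike (w : Word) : List ℕ :=
  (List.range (w.length + 1)).filter
    (fun i => (pad w).getD i true ≠ (pad w).getD (i + 1) true)

/-- One-step transition kernel of the discrete-time exclusion-voter chain with mixing
parameter `β` and exclusion parameter `p`: an unlike adjacent pair is chosen uniformly
at random; with probability `β` a voter move flips the pair to `00` or `11` (each with
probability `1/2`); with probability `1-β` an exclusion move swaps a `01` with
probability `p` and a `10` with probability `1-p` (otherwise no change). -/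
noncomputable def P (β p : ℝ) (w w' : Word) : ℝ :=
  ((unlike w).map (fun i =>
    let a := (pad w).getD i true
    let swapProb := if a then 1 - p else p
    ((unlike w).length : ℝ)⁻¹ *
      (β * (1 / 2) * (if strip (setPair (pad w) i false false) = w' then 1 else 0)
       + β * (1 / 2) * (if strip (setPair (pad w) i true true) = w' then 1 else 0)
       + (1 - β) * swapProb * (if strip (swapPair (pad w) i) = w' then 1 else 0)
       + (1 - β) * (1 - swapProb) * (if w = w' then 1 else 0)))).sum

/-- `n`-step transition probabilities. -/
noncomputable def Pn (β p : ℝ) : ℕ → Word → Word → ℝ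
  | 0 => fun w w' => if w = w' then 1 else 0
  | n + 1 => fun w w' => ∑' z : Word, Pn β p n w z * P β p z w'

/-- `w'` is accessible from `w`: some `n`-step transition probability is positive. -/
def Accessible (β p : ℝ) (w w' : Word) : Prop :=
  ∃ n : ℕ, 0 < n ∧ 0 < Pn β p n w w'

/-- Two states communicate: each is accessible from the other. -/
def Communicate (β p : ℝ) (w w' : Word) : Prop :=
  Accessible β p w w' ∧ Accessible β p w' w

instance : MeasurableSpace Word := ⊤

/-- `ξ` is (a realization of) the discrete-time exclusion-voter Markov chain with
parameters `(β, p)` under the probability measure `μ`. -/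
def IsEVChain (β p : ℝ) {Ω : Type*} [MeasurableSpace Ω] (μ : Measure Ω)
    (ξ : ℕ → Ω → Word) : Prop :=
  (∀ t, Measurable (ξ t)) ∧
  ∀ (t : ℕ) (path : ℕ → Word),
    μ {ω | ∀ i ≤ t + 1, ξ i ω = path i}
      = μ {ω | ∀ i ≤ t, ξ i ω = path i} * ENNReal.ofReal (P β p (path t) (path (t + 1)))

/-- The relaxation time `τ = min {t ∈ ℕ, t ≥ 1 : ξ_t = 𝒟₀}` (`∞` if there is no such `t`). -/
noncomputable def relaxTime {Ω : Type*} (ξ : ℕ → Ω → Word) (ω : Ω) : ℝ≥0∞ :=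
  sInf {r : ℝ≥0∞ | ∃ t : ℕ, 0 < t ∧ ξ t ω = groundState ∧ r = (t : ℝ≥0∞)}

/-- The size `|S|` of the hybrid zone. -/
def hz (w : Word) : ℕ := w.length

/-- The number of blocks `N(S)`: the number of (finite) `1`-blocks of the hybrid zone. -/
def nb (w : Word) : ℕ :=
  ((Finset.range w.length).filter
    (fun b => w.getD b false = true ∧ (b = 0 ∨ w.getD (b - 1) true = false))).card

/-- Number of `0`s among the first `c` positions of the hybrid zone. -/
def z0 (w : Word) (c : ℕ) : ℕ :=
  ((Finset.range c).filter (fun a => w.getD a true = false)).card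

/-- Number of `1`s of the hybrid zone at positions `≥ c`. -/
def o1 (w : Word) (c : ℕ) : ℕ :=
  ((Finset.Ico c w.length).filter (fun b => w.getD b false = true)).card

/-- `f₁(S) = Σᵢ mᵢ Rᵢ = Σᵢ nᵢ Tᵢ`: each `1` contributes the number of `0`s to its left. -/
def f1 (w : Word) : ℕ :=
  ∑ b ∈ (Finset.range w.length).filter (fun b => w.getD b false = true), z0 w b

/-- `f₂(S) = (1/2)(Σᵢ mᵢ Rᵢ² + Σᵢ nᵢ Tᵢ²)`: each `1` contributes the squared number of
`0`s to its left, each `0` the squared number of `1`s to its right. -/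
noncomputable def f2 (w : Word) : ℝ :=
  (1 / 2) *
    ((∑ b ∈ (Finset.range w.length).filter (fun b => w.getD b false = true),
        ((z0 w b : ℝ)) ^ 2)
     + (∑ a ∈ (Finset.range w.length).filter (fun a => w.getD a true = false),
        ((o1 w (a + 1) : ℝ)) ^ 2))

/-- `g(S) = max_{1 ≤ k ≤ N} R_k T_k`: the maximum over the `01`-corners of
(number of `0`s up to the corner) × (number of `1`s after the corner). -/
def gfun (w : Word) : ℕ :=
  ((Finset.range w.length).filter
    (fun a => w.getD a true = false ∧ w.getD (a + 1) false = true)).sup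
    (fun a => z0 w (a + 1) * o1 w (a + 1))

/-- `φ₁(S) = Σᵢ Σ_{j=R_{i-1}+1}^{R_i} Σ_{k=1}^{T_i} 1/(j+k)`: the `j`-th `0` (at position `a`,
so `j = z0 w (a+1)`) contributes `Σ_{k=1}^{T} 1/(j+k)` with `T` the number of `1`s to its right. -/
noncomputable def phi1 (w : Word) : ℝ :=
  ∑ a ∈ (Finset.range w.length).filter (fun a => w.getD a true = false),
    ∑ k ∈ Finset.Icc 1 (o1 w (a + 1)), (1 : ℝ) / ((z0 w (a + 1) : ℝ) + (k : ℝ))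

/-- The number of pairs consisting of a `0` and a later `1`. -/
def inv1 : Word → ℝ
  | [] => 0
  | x :: w => inv1 w + if x = false then (w.count true : ℝ) else 0

/-- The second-order inversion statistic, a submartingale for `p ≤ 1/2`. -/
noncomputable def inv2 : Word → ℝ
  | [] => 0
  | x :: w => inv2 w +
      if x = false then inv1 w + 1 / 2 * (w.count true : ℝ) * (w.count true + 1) else 0

lemma inv1_nonneg (w : Word) : 0 ≤ inv1 w := by
  induction w with
  | nil => simp [inv1]
  | cons x w ih => rw [inv1]; split_ifs <;> positivity

lemma inv2_nonneg (w : Word) : 0 ≤ inv2 w := by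
  induction w with
  | nil => simp [inv2]
  | cons x w ih =>
    have := inv1_nonneg w
    rw [inv2]; split_ifs <;> positivity

lemma inv1_le_length_mul_count (w : Word) : inv1 w ≤ w.length * (w.count true : ℝ) := by
  induction w with
  | nil => simp [inv1]
  | cons x w ih =>
    cases x
    · simp [inv1]; linarith
    · simp [inv1]
      have : (0 : ℝ) ≤ w.length := by positivity
      have : (0 : ℝ) ≤ (w.count true : ℝ) := by positivity
      nlinarith

lemma inv1_le_length_sq (w : Word) : inv1 w ≤ (w.length : ℝ) ^ 2 := by
  have h : (w.count true : ℝ) ≤ w.length := by exact_mod_cast List.count_le_length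
  have h0 : (0 : ℝ) ≤ w.length := by positivity
  nlinarith [inv1_le_length_mul_count w]

lemma inv2_le_inv1_sq (w : Word) : inv2 w ≤ inv1 w ^ 2 := by
  induction w with
  | nil => simp [inv1, inv2]
  | cons x w ih =>
    cases x
    · simp only [inv1, inv2, if_true]
      have h0 := inv1_nonneg w
      rcases Nat.eq_zero_or_pos (w.count true) with h | h
      · have := inv1_le_length_mul_count w
        rw [h] at this ⊢
        norm_num at this
        have : inv1 w = 0 := le_antisymm this h0
        rw [this] at ih ⊢
        simpa using ih
      · have h1 : (1 : ℝ) ≤ (w.count true : ℝ) := by exact_mod_cast h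
        nlinarith [mul_nonneg h0 (sub_nonneg.2 h1)]
    · simpa [inv1, inv2] using ih

lemma inv1_append (l r : Word) :
    inv1 (l ++ r) = inv1 l + inv1 r + (l.count false : ℝ) * (r.count true : ℝ) := by
  induction l with
  | nil => simp [inv1]
  | cons x l ih =>
    cases x
    · simp [inv1, ih]; ring
    · simp [inv1, ih]

lemma inv2_append (l r : Word) :
    inv2 (l ++ r) = inv2 l + inv2 r + (l.count false : ℝ) * inv1 r + (r.count true : ℝ) * inv1 l
      + 1 / 2 * (l.count false : ℝ) * (r.count true : ℝ)
        * ((l.count false : ℝ) + (r.count true : ℝ)) := by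
  induction l with
  | nil => simp [inv1, inv2]
  | cons x l ih =>
    cases x
    · simp [inv1, inv2, inv1_append, ih]; ring
    · simp [inv1, inv2, ih]

lemma inv1_eq_zero_of_count_true {w : Word} (h : w.count true = 0) : inv1 w = 0 :=
  le_antisymm (by simpa [h] using inv1_le_length_mul_count w) (inv1_nonneg w)

lemma inv1_eq_zero_of_count_false {w : Word} (h : w.count false = 0) : inv1 w = 0 := by
  induction w with
  | nil => simp [inv1]
  | cons x w ih => cases x <;> simp_all [inv1]

lemma inv2_eq_zero_of_inv1 {w : Word} (h : inv1 w = 0) : inv2 w = 0 :=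
  le_antisymm (by simpa [h] using inv2_le_inv1_sq w) (inv2_nonneg w)

lemma count_takeWhile_eq_zero (a b : Bool) (hab : a ≠ b) (w : Word) :
    (w.takeWhile (· = a)).count b = 0 := by
  rw [List.count_eq_zero]
  intro h
  have := List.mem_takeWhile_imp h
  simp at this
  exact hab this.symm

lemma exists_eq_strip (w : Word) :
    ∃ l r : Word, w = l ++ strip w ++ r ∧ l.count false = 0 ∧ r.count true = 0 := by
  refine ⟨w.takeWhile (· = true),
    ((w.dropWhile (· = true)).reverse.takeWhile (· = false)).reverse, ?_, ?_, ?_⟩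
  · rw [strip, List.append_assoc, ← List.reverse_append, List.takeWhile_append_dropWhile,
      List.reverse_reverse, List.takeWhile_append_dropWhile]
  · exact count_takeWhile_eq_zero _ _ (by simp) _
  · rw [List.count_reverse]
    exact count_takeWhile_eq_zero _ _ (by simp) _

lemma inv1_strip (w : Word) : inv1 (strip w) = inv1 w := by
  obtain ⟨l, r, h, hl, hr⟩ := exists_eq_strip w
  conv_rhs => rw [h]
  simp [inv1_append, hl, hr, inv1_eq_zero_of_count_false hl, inv1_eq_zero_of_count_true hr]

lemma inv2_strip (w : Word) : inv2 (strip w) = inv2 w := by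
  obtain ⟨l, r, h, hl, hr⟩ := exists_eq_strip w
  have h1 := inv1_eq_zero_of_count_false hl
  have h2 := inv1_eq_zero_of_count_true hr
  conv_rhs => rw [h]
  simp [inv2_append, hl, hr, h1, h2, inv2_eq_zero_of_inv1 h1, inv2_eq_zero_of_inv1 h2]

lemma length_strip_le (w : Word) : (strip w).length ≤ w.length := by
  obtain ⟨l, r, h, -, -⟩ := exists_eq_strip w
  have := congrArg List.length h
  simp at this
  omega

lemma inv1_pad (w : Word) : inv1 (pad w) = inv1 w := by
  simp [pad, inv1, inv1_append]

lemma inv2_pad (w : Word) : inv2 (pad w) = inv2 w := by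
  simp [pad, inv1, inv2, inv2_append]

lemma inv2_pos {w : Word} (hw : IsConfig w) (hne : w ≠ groundState) : 0 < inv2 w := by
  rcases hw with h | ⟨h1, h2⟩
  · exact absurd h hne
  · cases w with
    | nil => simp at h1
    | cons x w =>
      simp at h1
      subst h1
      have hmem : true ∈ w := by
        have := List.mem_of_getLast? h2
        simpa using this
      have hc : (0 : ℝ) < (w.count true : ℝ) := by
        exact_mod_cast List.count_pos_iff.2 hmem
      have := inv1_nonneg w
      have := inv2_nonneg w
      simp only [inv2, if_true]
      positivity

lemma setPair_append (l r : Word) (x y a b : Bool) :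
    setPair (l ++ x :: y :: r) l.length a b = l ++ a :: b :: r := by
  simp [setPair]

lemma exists_split (u : Word) (i : ℕ) (hi : i + 1 < u.length) :
    ∃ l r : Word, l.length = i ∧ u = l ++ u.getD i true :: u.getD (i + 1) true :: r := by
  refine ⟨u.take i, u.drop (i + 2), by simp; omega, ?_⟩
  rw [List.getD_eq_getElem _ _ hi, List.getD_eq_getElem _ _ (by omega : i < u.length)]
  rw [← List.drop_eq_getElem_cons, ← List.drop_eq_getElem_cons, List.take_append_drop]

/-- The expected value of `F` after a move at the pair of positions `i, i + 1`. -/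
noncomputable def pairMean (β p : ℝ) (F : Word → ℝ) (w : Word) (i : ℕ) : ℝ :=
  let swapProb := if (pad w).getD i true then 1 - p else p
  β * (1 / 2) * F (strip (setPair (pad w) i false false))
    + β * (1 / 2) * F (strip (setPair (pad w) i true true))
    + (1 - β) * swapProb * F (strip (swapPair (pad w) i))
    + (1 - β) * (1 - swapProb) * F w

/-- `0`s to the left plus `1`s to the right of the middle of the pair `i, i + 1`. -/
def cutCount (u : Word) (i : ℕ) : ℝ :=
  ((u.take (i + 1)).count false : ℝ) + ((u.drop (i + 1)).count true : ℝ)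

/-- The numerical value of the `i`-th letter. -/
def letter (u : Word) (i : ℕ) : ℝ := if u.getD i true then 1 else 0

lemma inv1_sub_one_le_pairMean {β p : ℝ} (hp0 : 0 ≤ p) (hp : p ≤ 1 / 2) (hβ1 : β ≤ 1) (w : Word) (i : ℕ) (hi : i < w.length + 1)
    (hne : (pad w).getD i true ≠ (pad w).getD (i + 1) true) :
    inv1 w - 1 ≤ pairMean β p inv1 w i := by
  obtain ⟨l, r, rfl, hu⟩ := exists_split (pad w) i (by simp [pad]; omega)
  rw [pairMean, swapPair, inv1_strip, inv1_strip, inv1_strip, ← inv1_pad w]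
  set x := (pad w).getD l.length true
  set y := (pad w).getD (l.length + 1) true
  rw [hu]
  simp only [setPair_append]
  clear_value x y
  have := mul_nonneg (sub_nonneg.2 hβ1) hp0
  have := mul_nonneg (sub_nonneg.2 hβ1) (by linarith : 0 ≤ 1 / 2 - p)
  cases x <;> cases y <;> simp [inv1_append, inv1] at hne ⊢ <;> nlinarith

lemma inv2_add_le_pairMean {β p : ℝ} (hp0 : 0 ≤ p) (hp : p ≤ 1 / 2)
    (hβ1 : β ≤ 1) (w : Word) (i : ℕ) (hi : i < w.length + 1)
    (hne : (pad w).getD i true ≠ (pad w).getD (i + 1) true) :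
    inv2 w + (β / 2 + (1 - β) * p) *
      ((letter (pad w) i - letter (pad w) (i + 1)) * cutCount (pad w) i)
      ≤ pairMean β p inv2 w i := by
  obtain ⟨l, r, rfl, hu⟩ := exists_split (pad w) i (by simp [pad]; omega)
  rw [pairMean, swapPair, inv2_strip, inv2_strip, inv2_strip, ← inv2_pad w, letter, letter]
  set x := (pad w).getD l.length true
  set y := (pad w).getD (l.length + 1) true
  rw [hu]
  simp only [setPair_append]
  have hc : cutCount (l ++ x :: y :: r) l.length
      = ((l ++ [x]).count false : ℝ) + ((y :: r).count true : ℝ) := by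
    have h : l ++ x :: y :: r = (l ++ [x]) ++ y :: r := by simp
    rw [cutCount, h, List.take_left' (by simp), List.drop_left' (by simp)]
  rw [hc]
  clear_value x y
  have h1 := mul_nonneg (sub_nonneg.2 hβ1) hp0
  have h2 := mul_nonneg (sub_nonneg.2 hβ1) (by linarith : 0 ≤ 1 / 2 - p)
  have hz : (0 : ℝ) ≤ (l.count false : ℝ) := by positivity
  have ho : (0 : ℝ) ≤ (r.count true : ℝ) := by positivity
  have h3 := mul_nonneg h2 hz
  have h4 := mul_nonneg h2 ho
  cases x <;> cases y <;> simp [inv2_append, inv2, inv1] at hne ⊢ <;> nlinarith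

lemma sum_letter_mul_cutCount (w : Word) :
    ∑ i ∈ Finset.range (w.length + 1),
      (letter (pad w) i - letter (pad w) (i + 1)) * cutCount (pad w) i = 0 := by
  have key : ∀ n ≤ w.length + 1, ∑ i ∈ Finset.range n,
      (letter (pad w) i - letter (pad w) (i + 1)) * cutCount (pad w) i
      = ((pad w).count true : ℝ) - ((pad w).take n).count true
        - letter (pad w) n * (((pad w).take n).count false + ((pad w).drop n).count true) := by
    intro n hn
    induction n with
    | zero => simp [letter, pad]
    | succ n ih =>
      rw [Finset.sum_range_succ, ih (by omega), cutCount]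
      have hlt : n < (pad w).length := by simp [pad]; omega
      rw [List.take_add_one, List.drop_eq_getElem_cons hlt]
      have hletter : letter (pad w) n = if (pad w)[n] then 1 else 0 := by
        rw [letter, List.getD_eq_getElem _ _ hlt]
      rw [hletter, List.getElem?_eq_getElem hlt]
      generalize letter (pad w) (n + 1) = y
      cases (pad w)[n] <;> simp <;> ring
  rw [key _ le_rfl]
  have h : pad w = (true :: w) ++ [false] := rfl
  have h2 : letter (pad w) (w.length + 1) = 0 := by
    simp [letter, pad]
  rw [h2, h, List.take_left' (by simp)]
  simp

lemma unlike_ne_nil (w : Word) : unlike w ≠ [] := by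
  intro h
  have h1 : ∀ i < w.length + 1, (pad w).getD i true = (pad w).getD (i + 1) true := by
    intro i hi
    by_contra hne
    have : i ∈ unlike w := by simpa [unlike, hi] using hne
    simp [h] at this
  have h2 : ∀ i ≤ w.length + 1, (pad w).getD i true = true := by
    intro i hi
    induction i with
    | zero => simp [pad]
    | succ i ih => rw [← h1 i (by omega), ih (by omega)]
  have := h2 _ le_rfl
  simp [pad] at this

lemma sum_map_unlike (w : Word) (f : ℕ → ℝ) :
    ((unlike w).map f).sum = ∑ i ∈ Finset.range (w.length + 1),
      if (pad w).getD i true ≠ (pad w).getD (i + 1) true then f i else 0 := by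
  rw [← Finset.sum_filter]
  simp [unlike, Finset.sum, Finset.range, Multiset.range]

lemma mem_unlike {w : Word} {i : ℕ} : i ∈ unlike w ↔
    i < w.length + 1 ∧ (pad w).getD i true ≠ (pad w).getD (i + 1) true := by
  simp [unlike]

/-- The expected value of `F` after one step. -/
noncomputable def stepMean (β p : ℝ) (F : Word → ℝ) (w : Word) : ℝ :=
  ((unlike w).map fun i => ((unlike w).length : ℝ)⁻¹ * pairMean β p F w i).sum

lemma unlike_length_pos (w : Word) : (0 : ℝ) < (unlike w).length := by
  exact_mod_cast List.length_pos_iff.2 (unlike_ne_nil w)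

lemma le_stepMean {β p : ℝ} {F : Word → ℝ} {w : Word} {c : ℝ} (f : ℕ → ℝ)
    (h : ∀ i ∈ unlike w, c + f i ≤ pairMean β p F w i)
    (hf : 0 ≤ ((unlike w).map f).sum) : c ≤ stepMean β p F w := by
  have hpos := unlike_length_pos w
  have h1 : ((unlike w).map fun i => c + f i).sum ≤ ((unlike w).map (pairMean β p F w)).sum :=
    List.sum_le_sum h
  rw [List.sum_map_add] at h1
  simp only [List.map_const', List.sum_replicate, nsmul_eq_mul] at h1
  rw [stepMean, List.sum_map_mul_left, ← div_eq_inv_mul, le_div_iff₀ hpos]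
  linarith

lemma inv1_le_stepMean_add_one {β p : ℝ} (hp0 : 0 ≤ p) (hp : p ≤ 1 / 2) (hβ1 : β ≤ 1) (w : Word) : inv1 w ≤ stepMean β p inv1 w + 1 := by
  rw [← sub_le_iff_le_add]
  refine le_stepMean (fun _ => 0) (fun i hi => ?_) (by simp)
  obtain ⟨hi, hne⟩ := mem_unlike.1 hi
  simpa using inv1_sub_one_le_pairMean hp0 hp hβ1 w i hi hne

lemma inv2_le_stepMean {β p : ℝ} (hp0 : 0 ≤ p) (hp : p ≤ 1 / 2)
    (hβ1 : β ≤ 1) (w : Word) : inv2 w ≤ stepMean β p inv2 w := by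
  refine le_stepMean _ (fun i hi => inv2_add_le_pairMean hp0 hp hβ1 w i
    (mem_unlike.1 hi).1 (mem_unlike.1 hi).2) ?_
  rw [List.sum_map_mul_left, sum_map_unlike]
  rw [Finset.sum_congr rfl (g := fun i =>
    (letter (pad w) i - letter (pad w) (i + 1)) * cutCount (pad w) i),
    sum_letter_mul_cutCount, mul_zero]
  intro i _
  split_ifs with h
  · rfl
  · rw [not_not] at h
    rw [letter, letter, h, sub_self, zero_mul]

/-- The possible outcomes of one step, with their probabilities. -/
noncomputable def moves (β p : ℝ) (w : Word) : List (ℝ × Word) :=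
  (unlike w).flatMap fun i =>
    let swapProb := if (pad w).getD i true then 1 - p else p
    let c := ((unlike w).length : ℝ)⁻¹
    [(c * (β * (1 / 2)), strip (setPair (pad w) i false false)),
      (c * (β * (1 / 2)), strip (setPair (pad w) i true true)),
      (c * ((1 - β) * swapProb), strip (swapPair (pad w) i)),
      (c * ((1 - β) * (1 - swapProb)), w)]

lemma sum_map_flatMap {α γ : Type*} (l : List α) (f : α → List γ) (g : γ → ℝ) :
    ((l.flatMap f).map g).sum = (l.map fun i => ((f i).map g).sum).sum := by
  induction l with
  | nil => simp
  | cons a l ih => simp [ih]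

lemma P_eq_sum_moves (β p : ℝ) (w w' : Word) :
    P β p w w' = ((moves β p w).map fun m => m.1 * if m.2 = w' then 1 else 0).sum := by
  rw [moves, sum_map_flatMap, P]
  congr 1
  refine List.map_congr_left fun i _ => ?_
  simp only [List.map_cons, List.map_nil, List.sum_cons, List.sum_nil]
  ring

lemma stepMean_eq_sum_moves (β p : ℝ) (F : Word → ℝ) (w : Word) :
    stepMean β p F w = ((moves β p w).map fun m => m.1 * F m.2).sum := by
  rw [moves, sum_map_flatMap, stepMean]
  congr 1
  refine List.map_congr_left fun i _ => ?_
  simp only [pairMean, List.map_cons, List.map_nil, List.sum_cons, List.sum_nil]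
  ring

lemma moves_nonneg {β p : ℝ} (hp0 : 0 ≤ p) (hp : p ≤ 1 / 2) (hβ0 : 0 ≤ β) (hβ1 : β ≤ 1)
    {w : Word} {m : ℝ × Word} (hm : m ∈ moves β p w) : 0 ≤ m.1 := by
  simp only [moves, List.mem_flatMap, List.mem_cons, List.not_mem_nil, or_false] at hm
  have h1 : 0 ≤ 1 - β := by linarith
  have h2 : 0 ≤ 1 - p := by linarith
  obtain ⟨i, -, rfl | rfl | rfl | rfl⟩ := hm <;> dsimp only
  · positivity
  · positivity
  · split_ifs <;> positivity
  · split_ifs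
    · rw [sub_sub_cancel]; positivity
    · positivity

lemma length_setPair (u : Word) (i : ℕ) (a b : Bool) : (setPair u i a b).length = u.length := by
  simp [setPair]

lemma length_le_of_mem_moves {β p : ℝ} {w : Word} {m : ℝ × Word} (hm : m ∈ moves β p w) :
    m.2.length ≤ w.length + 2 := by
  simp only [moves, List.mem_flatMap, List.mem_cons, List.not_mem_nil, or_false] at hm
  have hpad : (pad w).length = w.length + 2 := by simp [pad]
  obtain ⟨i, -, rfl | rfl | rfl | rfl⟩ := hm
  · exact (length_strip_le _).trans (by rw [length_setPair, hpad])
  · exact (length_strip_le _).trans (by rw [length_setPair, hpad])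
  · exact (length_strip_le _).trans (by rw [swapPair, length_setPair, hpad])
  · exact Nat.le_add_right _ _

lemma P_eq_zero_of_length {β p : ℝ} {w w' : Word} (h : w.length + 2 < w'.length) :
    P β p w w' = 0 := by
  rw [P_eq_sum_moves]
  refine List.sum_eq_zero fun x hx => ?_
  obtain ⟨m, hm, rfl⟩ := List.mem_map.1 hx
  have := length_le_of_mem_moves hm
  rw [if_neg (by rintro rfl; omega), mul_zero]

lemma sum_map_nonneg {α : Type*} {l : List α} {f : α → ℝ} (h : ∀ a ∈ l, 0 ≤ f a) :
    0 ≤ (l.map f).sum :=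
  List.sum_nonneg fun x hx => by
    obtain ⟨a, ha, rfl⟩ := List.mem_map.1 hx
    exact h a ha

lemma tsum_ofReal_sum_indicator_mul (L : List (ℝ × Word)) (hL : ∀ m ∈ L, 0 ≤ m.1)
    (F : Word → ℝ) (hF : ∀ w, 0 ≤ F w) :
    ∑' w', ENNReal.ofReal (L.map fun m => m.1 * if m.2 = w' then 1 else 0).sum
      * ENNReal.ofReal (F w') = ENNReal.ofReal (L.map fun m => m.1 * F m.2).sum := by
  induction L with
  | nil => simp
  | cons m L ih =>
    have hL' : ∀ m ∈ L, 0 ≤ m.1 := fun m hm => hL m (List.mem_cons_of_mem _ hm)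
    have hm : 0 ≤ m.1 := hL m List.mem_cons_self
    simp only [List.map_cons, List.sum_cons]
    rw [ENNReal.ofReal_add (mul_nonneg hm (hF _))
      (sum_map_nonneg fun a ha => mul_nonneg (hL' a ha) (hF _)), ← ih hL']
    rw [ENNReal.ofReal_mul hm, ← tsum_ite_eq m.2 fun w' => ENNReal.ofReal m.1 *
      ENNReal.ofReal (F w'), ← ENNReal.tsum_add]
    refine tsum_congr fun w' => ?_
    rw [ENNReal.ofReal_add (by split_ifs <;> simp [hm])
      (sum_map_nonneg fun a ha => mul_nonneg (hL' a ha) (by split_ifs <;> simp)), add_mul]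
    congr 1
    by_cases h : m.2 = w'
    · simp [h]
    · simp [h, Ne.symm h]

lemma tsum_P_mul {β p : ℝ} (hp0 : 0 ≤ p) (hp : p ≤ 1 / 2) (hβ0 : 0 ≤ β) (hβ1 : β ≤ 1)
    (w : Word) (F : Word → ℝ) (hF : ∀ w, 0 ≤ F w) :
    ∑' w', ENNReal.ofReal (P β p w w') * ENNReal.ofReal (F w')
      = ENNReal.ofReal (stepMean β p F w) := by
  simp only [P_eq_sum_moves, stepMean_eq_sum_moves]
  exact tsum_ofReal_sum_indicator_mul _ (fun m hm => moves_nonneg hp0 hp hβ0 hβ1 hm) F hF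

lemma stepMean_one (β p : ℝ) (w : Word) : stepMean β p (fun _ => 1) w = 1 := by
  have h : ∀ i, pairMean β p (fun _ => 1) w i = 1 := fun i => by
    simp only [pairMean]; ring
  have := (unlike_length_pos w).ne'
  simp [stepMean, h, this]

/-- One step of the transition semigroup killed in the ground state. -/
noncomputable def killedStep (β p : ℝ) (g : Word → ℝ≥0∞) (w : Word) : ℝ≥0∞ :=
  ∑' w', ENNReal.ofReal (P β p w w') * (if w' = groundState then 0 else g w')

lemma killedStep_mono (β p : ℝ) : Monotone (killedStep β p) := by
  intro g h hgh w
  refine ENNReal.tsum_le_tsum fun w' => ?_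
  gcongr
  split_ifs
  · exact le_rfl
  · exact hgh w'

lemma killedStep_tsum (β p : ℝ) (g : ℕ → Word → ℝ≥0∞) :
    killedStep β p (fun w => ∑' s, g s w) = fun w => ∑' s, killedStep β p (g s) w := by
  funext w
  simp only [killedStep]
  rw [ENNReal.tsum_comm]
  refine tsum_congr fun w' => ?_
  rw [ENNReal.tsum_mul_left]
  split_ifs <;> simp

lemma killedStep_add (β p : ℝ) (g h : Word → ℝ≥0∞) :
    killedStep β p (g + h) = killedStep β p g + killedStep β p h := by
  funext w
  simp only [killedStep, Pi.add_apply]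
  rw [← ENNReal.tsum_add]
  refine tsum_congr fun w' => ?_
  split_ifs <;> simp [mul_add]

lemma killedStep_const_mul (β p : ℝ) (c : ℝ≥0∞) (g : Word → ℝ≥0∞) :
    killedStep β p (fun w => c * g w) = fun w => c * killedStep β p g w := by
  funext w
  simp only [killedStep]
  rw [← ENNReal.tsum_mul_left]
  refine tsum_congr fun w' => ?_
  split_ifs
  · simp
  · ring

lemma killedStep_ofReal {β p : ℝ} (hp0 : 0 ≤ p) (hp : p ≤ 1 / 2) (hβ0 : 0 ≤ β) (hβ1 : β ≤ 1)
    (F : Word → ℝ) (hF : ∀ w, 0 ≤ F w) (hF0 : F groundState = 0) (w : Word) :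
    killedStep β p (fun w => ENNReal.ofReal (F w)) w = ENNReal.ofReal (stepMean β p F w) := by
  rw [← tsum_P_mul hp0 hp hβ0 hβ1 w F hF, killedStep]
  refine tsum_congr fun w' => ?_
  split_ifs with h
  · simp [h, hF0]
  · rfl

lemma killedStep_one_le {β p : ℝ} (hp0 : 0 ≤ p) (hp : p ≤ 1 / 2) (hβ0 : 0 ≤ β) (hβ1 : β ≤ 1) :
    killedStep β p 1 ≤ 1 := by
  intro w
  have h := tsum_P_mul hp0 hp hβ0 hβ1 w (fun _ => 1) (fun _ => zero_le_one)
  rw [stepMean_one, ENNReal.ofReal_one] at h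
  rw [Pi.one_apply, ← h]
  refine ENNReal.tsum_le_tsum fun w' => ?_
  gcongr
  split_ifs <;> simp

/-- The probability, starting from `w`, of avoiding the ground state at times `1, …, n`. -/
noncomputable def survival (β p : ℝ) (n : ℕ) : Word → ℝ≥0∞ := (killedStep β p)^[n] 1

lemma killedStep_iterate_tsum (β p : ℝ) (n : ℕ) (g : ℕ → Word → ℝ≥0∞) :
    (killedStep β p)^[n] (fun w => ∑' s, g s w)
      = fun w => ∑' s, (killedStep β p)^[n] (g s) w := by
  induction n with
  | zero => rfl
  | succ n ih => simp only [Function.iterate_succ_apply', ih, killedStep_tsum]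

lemma killedStep_iterate_add (β p : ℝ) (n : ℕ) (g h : Word → ℝ≥0∞) :
    (killedStep β p)^[n] (g + h) = (killedStep β p)^[n] g + (killedStep β p)^[n] h := by
  induction n with
  | zero => rfl
  | succ n ih => simp only [Function.iterate_succ_apply', ih, killedStep_add]

lemma killedStep_iterate_const_mul (β p : ℝ) (n : ℕ) (c : ℝ≥0∞) (g : Word → ℝ≥0∞) :
    (killedStep β p)^[n] (fun w => c * g w) = fun w => c * (killedStep β p)^[n] g w := by
  induction n with
  | zero => rfl
  | succ n ih => simp only [Function.iterate_succ_apply', ih, killedStep_const_mul]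

/-- The second moment of the relaxation time, as a function of the initial configuration. -/
noncomputable def secondMoment (β p : ℝ) (w : Word) : ℝ≥0∞ :=
  ∑' s : ℕ, (2 * s + 1 : ℝ≥0∞) * survival β p s w

lemma killedStep_iterate_survival (β p : ℝ) (t s : ℕ) :
    (killedStep β p)^[t] (survival β p s) = survival β p (s + t) := by
  rw [survival, survival, add_comm, Function.iterate_add_apply]

lemma killedStep_iterate_secondMoment_le (β p : ℝ) (t : ℕ) (w : Word) :
    (killedStep β p)^[t] (secondMoment β p) w
      ≤ ∑' s : ℕ, (2 * (s + t : ℕ) + 1 : ℝ≥0∞) * survival β p (s + t) w := by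
  unfold secondMoment
  rw [killedStep_iterate_tsum]
  refine ENNReal.tsum_le_tsum fun s => ?_
  rw [killedStep_iterate_const_mul, killedStep_iterate_survival]
  refine mul_le_mul' ?_ le_rfl
  exact_mod_cast (by omega : 2 * s + 1 ≤ 2 * (s + t) + 1)

lemma survival_antitone {β p : ℝ} (hp0 : 0 ≤ p) (hp : p ≤ 1 / 2) (hβ0 : 0 ≤ β) (hβ1 : β ≤ 1) :
    Antitone (survival β p) := by
  refine antitone_nat_of_succ_le fun n => ?_
  rw [survival, Function.iterate_succ_apply]
  exact (killedStep_mono β p).iterate n (killedStep_one_le hp0 hp hβ0 hβ1)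

lemma sq_tsum_le {a : ℕ → ℝ≥0∞} (ha : ∀ s, a s ≤ 1) :
    (∑' s, a s) ^ 2 ≤ ∑' s : ℕ, (2 * s + 1 : ℝ≥0∞) * a s := by
  have hfin : ∀ n : ℕ, (∑ s ∈ Finset.range n, a s) ^ 2
      ≤ ∑ s ∈ Finset.range n, (2 * s + 1 : ℝ≥0∞) * a s := by
    intro n
    induction n with
    | zero => simp
    | succ n ih =>
      rw [Finset.sum_range_succ, Finset.sum_range_succ]
      have h1 : ∑ s ∈ Finset.range n, a s ≤ n := by
        simpa using Finset.sum_le_sum fun s (_ : s ∈ Finset.range n) => ha s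
      calc (∑ s ∈ Finset.range n, a s + a n) ^ 2
          = (∑ s ∈ Finset.range n, a s) ^ 2
            + (2 * ∑ s ∈ Finset.range n, a s + a n) * a n := by ring
        _ ≤ _ := by gcongr; exact ha n
  refine le_of_tendsto' ((ENNReal.continuous_pow 2).continuousAt.tendsto.comp
    ENNReal.summable.hasSum.tendsto_sum_nat) fun n => ?_
  exact (hfin n).trans (ENNReal.sum_le_tsum _)

lemma le_tsum_of_forall_le_add {a : ℕ → ℝ≥0∞} (ha : Antitone a)
    (hfin : ∑' s : ℕ, (2 * s + 1 : ℝ≥0∞) * a s ≠ ⊤) {x : ℝ≥0∞} {k : ℕ}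
    (h : ∀ n : ℕ, x ≤ ∑ s ∈ Finset.range n, a s + (k + 2 * n : ℝ≥0∞) ^ 2 * a n) :
    x ≤ ∑' s, a s := by
  have htail := ENNReal.tendsto_sum_nat_add (fun s : ℕ => (2 * s + 1 : ℝ≥0∞) * a s) hfin
  have hlim : Tendsto (fun m : ℕ => ∑' s, a s
      + 25 * ∑' s : ℕ, (2 * (s + m : ℕ) + 1 : ℝ≥0∞) * a (s + m)) atTop (nhds (∑' s, a s)) := by
    have := (ENNReal.Tendsto.const_mul (a := 25) htail (Or.inr (by simp))).const_add (∑' s, a s)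
    simpa using this
  refine ge_of_tendsto hlim ?_
  filter_upwards [eventually_ge_atTop k] with m hm
  refine (h (2 * m)).trans ?_
  refine add_le_add (ENNReal.sum_le_tsum _) ?_
  calc (k + 2 * (2 * m : ℕ) : ℝ≥0∞) ^ 2 * a (2 * m)
      ≤ (5 * m : ℝ≥0∞) ^ 2 * a (2 * m) := by
        gcongr
        exact_mod_cast (by omega : k + 2 * (2 * m) ≤ 5 * m)
    _ = 25 * ∑ s ∈ Finset.range m, (m : ℝ≥0∞) * a (2 * m) := by
        rw [Finset.sum_const, Finset.card_range, nsmul_eq_mul]; ring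
    _ ≤ 25 * ∑ s ∈ Finset.range m, (2 * (s + m : ℕ) + 1 : ℝ≥0∞) * a (s + m) := by
        gcongr with s hs
        · exact_mod_cast (by omega : m ≤ 2 * (s + m) + 1)
        · exact ha (by have := Finset.mem_range.1 hs; omega)
    _ ≤ _ := by gcongr; exact ENNReal.sum_le_tsum _

lemma ofReal_inv1_le {β p : ℝ} (hp0 : 0 ≤ p) (hp : p ≤ 1 / 2) (hβ0 : 0 ≤ β) (hβ1 : β ≤ 1)
    (n : ℕ) (w : Word) :
    ENNReal.ofReal (inv1 w) ≤ ∑ s ∈ Finset.range n, survival β p s w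
      + (killedStep β p)^[n] (fun w => ENNReal.ofReal (inv1 w)) w := by
  have hstep : (fun w => ENNReal.ofReal (inv1 w))
      ≤ killedStep β p (fun w => ENNReal.ofReal (inv1 w)) + 1 := by
    intro w
    rw [Pi.add_apply, killedStep_ofReal hp0 hp hβ0 hβ1 _ inv1_nonneg rfl, Pi.one_apply]
    refine (ENNReal.ofReal_le_ofReal (inv1_le_stepMean_add_one hp0 hp hβ1 w)).trans ?_
    exact ENNReal.ofReal_add_le.trans (by simp)
  induction n with
  | zero => simp
  | succ n ih =>
    refine ih.trans ?_
    rw [Finset.sum_range_succ, add_assoc]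
    gcongr
    have := (killedStep_mono β p).iterate n hstep w
    rw [killedStep_iterate_add, ← Function.iterate_succ_apply] at this
    rw [add_comm]
    exact this

lemma killedStep_iterate_inv1_le (β p : ℝ) (n : ℕ) (w : Word) :
    (killedStep β p)^[n] (fun w => ENNReal.ofReal (inv1 w)) w
      ≤ (w.length + 2 * n : ℝ≥0∞) ^ 2 * survival β p n w := by
  induction n generalizing w with
  | zero =>
    simp only [Function.iterate_zero, id_eq, survival, Pi.one_apply, mul_one, Nat.cast_zero,
      mul_zero, add_zero]
    refine (ENNReal.ofReal_le_ofReal (inv1_le_length_sq w)).trans ?_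
    rw [ENNReal.ofReal_pow (by positivity), ENNReal.ofReal_natCast]
  | succ n ih =>
    rw [survival, Function.iterate_succ_apply', Function.iterate_succ_apply', ← survival,
      killedStep, killedStep, ← ENNReal.tsum_mul_left]
    refine ENNReal.tsum_le_tsum fun w' => ?_
    by_cases hlen : w.length + 2 < w'.length
    · simp [P_eq_zero_of_length hlen]
    · rw [mul_left_comm]
      gcongr
      split_ifs
      · simp
      · refine (ih w').trans ?_
        refine mul_le_mul' (pow_le_pow_left' ?_ 2) le_rfl
        exact_mod_cast (by omega : w'.length + 2 * n ≤ w.length + 2 * (n + 1))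

lemma ofReal_inv2_le_secondMoment {β p : ℝ} (hp0 : 0 ≤ p) (hp : p ≤ 1 / 2) (hβ0 : 0 ≤ β) (hβ1 : β ≤ 1)
    (w : Word) :
    ENNReal.ofReal (inv2 w) ≤ secondMoment β p w := by
  by_cases hfin : secondMoment β p w = ⊤
  · simp [hfin]
  have hanti := survival_antitone hp0 hp hβ0 hβ1
  have h1 : ENNReal.ofReal (inv1 w) ≤ ∑' s, survival β p s w :=
    le_tsum_of_forall_le_add (k := w.length) (fun m n h => hanti h w) hfin fun n =>
      (ofReal_inv1_le hp0 hp hβ0 hβ1 n w).trans (by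
        gcongr
        exact killedStep_iterate_inv1_le β p n w)
  calc ENNReal.ofReal (inv2 w) ≤ ENNReal.ofReal (inv1 w) ^ 2 := by
        rw [← ENNReal.ofReal_pow (inv1_nonneg w)]
        exact ENNReal.ofReal_le_ofReal (inv2_le_inv1_sq w)
    _ ≤ (∑' s, survival β p s w) ^ 2 := by gcongr
    _ ≤ _ := sq_tsum_le fun s => hanti (Nat.zero_le s) w

theorem secondMoment_eq_top {β p : ℝ} (hp0 : 0 ≤ p) (hp : p ≤ 1 / 2) (hβ0 : 0 ≤ β) (hβ1 : β ≤ 1)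
    {w : Word} (hw : IsConfig w) (hne : w ≠ groundState) :
    secondMoment β p w = ⊤ := by
  by_contra hfin
  have hstep : (fun w => ENNReal.ofReal (inv2 w))
      ≤ killedStep β p (fun w => ENNReal.ofReal (inv2 w)) := by
    intro w
    rw [killedStep_ofReal hp0 hp hβ0 hβ1 _ inv2_nonneg rfl]
    exact ENNReal.ofReal_le_ofReal (inv2_le_stepMean hp0 hp hβ1 w)
  have hmono := killedStep_mono β p
  have hle : ∀ t : ℕ, ENNReal.ofReal (inv2 w)
      ≤ ∑' s : ℕ, (2 * (s + t : ℕ) + 1 : ℝ≥0∞) * survival β p (s + t) w := fun t =>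
    calc ENNReal.ofReal (inv2 w)
        ≤ (killedStep β p)^[t] (fun w => ENNReal.ofReal (inv2 w)) w :=
          hmono.monotone_iterate_of_le_map hstep (Nat.zero_le t) w
      _ ≤ (killedStep β p)^[t] (secondMoment β p) w :=
          hmono.iterate t (ofReal_inv2_le_secondMoment hp0 hp hβ0 hβ1) w
      _ ≤ _ := killedStep_iterate_secondMoment_le β p t w
  have hlim := ENNReal.tendsto_sum_nat_add
    (fun s : ℕ => (2 * s + 1 : ℝ≥0∞) * survival β p s w) hfin
  have h0 := ge_of_tendsto' hlim hle
  exact absurd (inv2_pos hw hne) (not_lt.2 (ENNReal.ofReal_eq_zero.1 (le_antisymm h0 zero_le)))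

lemma measure_path_avoid {β p : ℝ} {Ω : Type*} [MeasurableSpace Ω] {μ : Measure Ω}
    {ξ : ℕ → Ω → Word} (hchain : IsEVChain β p μ ξ) (n : ℕ) :
    ∀ (s : ℕ) (path : ℕ → Word),
      μ {ω | (∀ i ≤ s, ξ i ω = path i) ∧ ∀ i, s < i → i ≤ s + n → ξ i ω ≠ groundState}
        = μ {ω | ∀ i ≤ s, ξ i ω = path i} * survival β p n (path s) := by
  induction n with
  | zero =>
    intro s path
    simp only [survival, Function.iterate_zero, id_eq, Pi.one_apply, mul_one]
    congr 1
    ext ω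
    simp only [Set.mem_ofPred_eq, and_iff_left_iff_imp]
    intro _ i h1 h2
    omega
  | succ n ih =>
    intro s path
    set A : Set Ω :=
      {ω | (∀ i ≤ s, ξ i ω = path i) ∧ ∀ i, s < i → i ≤ s + (n + 1) → ξ i ω ≠ groundState} with hA
    have hAmeas : MeasurableSet A := by
      have h1 : ∀ i w, MeasurableSet {ω | ξ i ω = w} := fun i w =>
        hchain.1 i (measurableSet_singleton w)
      simp only [hA, Set.ofPred_and, Set.ofPred_forall]
      refine (MeasurableSet.iInter fun i => MeasurableSet.iInter fun _ => h1 _ _).inter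
        (MeasurableSet.iInter fun i => MeasurableSet.iInter fun _ => MeasurableSet.iInter fun _ =>
          (h1 _ _).compl)
    have hsplit : μ A = ∑' w', μ (A ∩ ξ (s + 1) ⁻¹' {w'}) := by
      rw [← measure_iUnion]
      · congr 1
        ext ω
        simp
      · intro a b hab
        refine Set.disjoint_left.2 fun ω ha hb => hab ?_
        exact ha.2.symm.trans hb.2
      · exact fun w' => hAmeas.inter (hchain.1 (s + 1) (measurableSet_singleton w'))
    rw [hsplit, survival, Function.iterate_succ_apply', ← survival, killedStep,
      ← ENNReal.tsum_mul_left]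
    refine tsum_congr fun w' => ?_
    split_ifs with hw'
    · rw [mul_zero, mul_zero]
      convert measure_empty (μ := μ)
      ext ω
      simp only [hA, Set.mem_inter_iff, Set.mem_ofPred_eq, Set.mem_preimage, Set.mem_singleton_iff,
        Set.mem_empty_iff_false, iff_false]
      rintro ⟨⟨-, h⟩, h'⟩
      exact h (s + 1) (by omega) (by omega) (h'.trans hw')
    · have hpath : ∀ i ≤ s, Function.update path (s + 1) w' i = path i := fun i hi =>
        Function.update_of_ne (by omega) _ _
      have hself : Function.update path (s + 1) w' (s + 1) = w' := Function.update_self _ _ _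
      have h1 := ih (s + 1) (Function.update path (s + 1) w')
      rw [hchain.2, hself, hpath s le_rfl, mul_assoc] at h1
      have h2 : {ω | ∀ i ≤ s, ξ i ω = Function.update path (s + 1) w' i}
          = {ω | ∀ i ≤ s, ξ i ω = path i} := by
        ext ω
        exact forall₂_congr fun i hi => by rw [hpath i hi]
      rw [h2] at h1
      rw [← h1]
      congr 1
      ext ω
      simp only [hA, Set.mem_inter_iff, Set.mem_ofPred_eq, Set.mem_preimage, Set.mem_singleton_iff]
      constructor
      · rintro ⟨⟨ha, hb⟩, hc⟩
        refine ⟨fun i hi => ?_, fun i hi hi' => hb i (by omega) (by omega)⟩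
        rcases Nat.lt_or_ge s i with h | h
        · obtain rfl : i = s + 1 := by omega
          rw [hc, hself]
        · rw [ha i h, hpath i h]
      · rintro ⟨ha, hb⟩
        have hc : ξ (s + 1) ω = w' := by rw [ha (s + 1) le_rfl, hself]
        refine ⟨⟨fun i hi => by rw [ha i (by omega), hpath i hi], fun i hi hi' => ?_⟩, hc⟩
        rcases Nat.lt_or_ge (s + 1) i with h | h
        · exact hb i h (by omega)
        · obtain rfl : i = s + 1 := by omega
          rwa [hc]

lemma measure_avoid {β p : ℝ} {Ω : Type*} [MeasurableSpace Ω] {μ : Measure Ω}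
    [IsProbabilityMeasure μ] {ξ : ℕ → Ω → Word} (hchain : IsEVChain β p μ ξ) {S₀ : Word}
    (hinit : ∀ᵐ ω ∂μ, ξ 0 ω = S₀) (n : ℕ) :
    μ {ω | ∀ i, 0 < i → i ≤ n → ξ i ω ≠ groundState} = survival β p n S₀ := by
  have h := measure_path_avoid hchain n 0 fun _ => S₀
  have h0 : μ {ω | ∀ i ≤ 0, ξ i ω = S₀} = 1 := by
    rw [← measure_univ (μ := μ)]
    refine measure_congr ?_
    filter_upwards [hinit] with ω hω
    refine propext ⟨fun _ => trivial, fun _ i hi => ?_⟩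
    rw [Nat.le_zero.1 hi, hω]
  rw [h0, one_mul, zero_add] at h
  rw [← h]
  refine measure_congr ?_
  filter_upwards [hinit] with ω hω
  refine propext ⟨fun h => ⟨fun i hi => ?_, h⟩, fun h => h.2⟩
  rw [Nat.le_zero.1 hi, hω]

lemma one_le_relaxTime {Ω : Type*} (ξ : ℕ → Ω → Word) (ω : Ω) : 1 ≤ relaxTime ξ ω := by
  refine le_sInf ?_
  rintro r ⟨t, ht, -, rfl⟩
  exact_mod_cast ht

lemma sum_range_odd (k : ℕ) :
    ∑ t ∈ Finset.range k, (2 * t + 1 : ℝ≥0∞) = (k : ℝ≥0∞) ^ 2 := by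
  induction k with
  | zero => simp
  | succ k ih => rw [Finset.sum_range_succ, ih]; push_cast; ring

lemma tsum_indicator_le_relaxTime_sq {Ω : Type*} (ξ : ℕ → Ω → Word) (ω : Ω) :
    ∑' t : ℕ, {ω | ∀ i, 0 < i → i ≤ t → ξ i ω ≠ groundState}.indicator
      (fun _ => (2 * t + 1 : ℝ≥0∞)) ω ≤ relaxTime ξ ω ^ 2 := by
  classical
  by_cases hex : ∃ t, 0 < t ∧ ξ t ω = groundState
  · have hk := Nat.find_spec hex
    have hle : ((Nat.find hex : ℕ) : ℝ≥0∞) ≤ relaxTime ξ ω := by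
      refine le_sInf ?_
      rintro r ⟨t, ht, ht', rfl⟩
      exact_mod_cast Nat.find_min' hex ⟨ht, ht'⟩
    rw [tsum_eq_sum (s := Finset.range (Nat.find hex))]
    · refine (Finset.sum_le_sum fun t _ => Set.indicator_le_self' (fun _ _ => zero_le) ω).trans ?_
      rw [sum_range_odd]
      gcongr
    · intro t ht
      refine Set.indicator_of_notMem (fun h => ?_) _
      exact h _ hk.1 (by simpa using ht) hk.2
  · have : relaxTime ξ ω = ⊤ := by
      refine sInf_eq_top.2 ?_
      rintro r ⟨t, ht, ht', rfl⟩
      exact absurd ⟨t, ht, ht'⟩ hex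
    simp [this]

/-- Theorem 3: for `p ≤ 1/2` and `β ∈ [0,1]`, the relaxation time satisfies
`E_{β,p}[τ^{2+ε} | ξ₀ = S₀] = ∞` for every `ε > 0` and every `S₀ ∈ 𝒟 ∖ {𝒟₀}`. -/
theorem relaxTime_moment_two_plus_eps_infinite
    (p : ℝ) (hp0 : 0 ≤ p) (hp : p ≤ 1 / 2)
    (β : ℝ) (hβ0 : 0 ≤ β) (hβ1 : β ≤ 1)
    (ε : ℝ) (hε : 0 < ε)
    (S₀ : Word) (hS₀ : IsConfig S₀) (hS₀ne : S₀ ≠ groundState)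
    {Ω : Type*} [MeasurableSpace Ω] (μ : Measure Ω) [IsProbabilityMeasure μ]
    (ξ : ℕ → Ω → Word) (hchain : IsEVChain β p μ ξ)
    (hinit : ∀ᵐ ω ∂μ, ξ 0 ω = S₀) :
    ∫⁻ ω, relaxTime ξ ω ^ (2 + ε) ∂μ = ⊤ := by
  have hmeas : ∀ t : ℕ, MeasurableSet {ω | ∀ i, 0 < i → i ≤ t → ξ i ω ≠ groundState} := by
    intro t
    simp only [Set.ofPred_forall]
    exact MeasurableSet.iInter fun i => MeasurableSet.iInter fun _ => MeasurableSet.iInter fun _ =>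
      (hchain.1 i (measurableSet_singleton groundState)).compl
  rw [eq_top_iff]
  calc ⊤ = secondMoment β p S₀ := (secondMoment_eq_top hp0 hp hβ0 hβ1 hS₀ hS₀ne).symm
    _ = ∑' t : ℕ, ∫⁻ ω, {ω | ∀ i, 0 < i → i ≤ t → ξ i ω ≠ groundState}.indicator
          (fun _ => (2 * t + 1 : ℝ≥0∞)) ω ∂μ := by
        refine tsum_congr fun t => ?_
        rw [lintegral_indicator_const (hmeas t), measure_avoid hchain hinit]
    _ = ∫⁻ ω, ∑' t : ℕ, {ω | ∀ i, 0 < i → i ≤ t → ξ i ω ≠ groundState}.indicator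
          (fun _ => (2 * t + 1 : ℝ≥0∞)) ω ∂μ :=
        (lintegral_tsum fun t => (measurable_const.indicator (hmeas t)).aemeasurable).symm
    _ ≤ ∫⁻ ω, relaxTime ξ ω ^ (2 + ε) ∂μ := by
        refine lintegral_mono fun ω => (tsum_indicator_le_relaxTime_sq ξ ω).trans ?_
        rw [← ENNReal.rpow_natCast]
        exact ENNReal.rpow_le_rpow_of_exponent_le (one_le_relaxTime ξ ω) (by norm_num; linarith)

end EV
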